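/- Let φ be a Schwartz function on ℝ with 𝓕φ even, nonnegative, equal to 1 on |ξ| ≤ 1/4 and supported in |ξ| ≤ 1/2, and let s > max{1 + 1/p, 3/2}, 1 ≤ p, r ≤ ∞. With f_n(x) = 2^{-ns}φ(x)sin((17/12)2ⁿx) and g_n(x) = 2^{-n/2}φ(x), set v_{0,n} = f_n + g_n and ρ̃_{0,n} = 2ⁿ f_n + g_n. Then the quantities w₀ⁿ = (v_{0,n})² ∂_x ρ̃_{0,n} and v₀ⁿ = (v_{0,n})² ∂_x v_{0,n} satisfy: ‖v₀ⁿ‖_{B^{s-1}_{p,r}} ≤ C 2^{-n}, ‖w₀ⁿ‖_{B^{s-1}_{p,r}} ≤ C, and ‖w₀ⁿ‖_{B^{s-2}_{p,r}} ≤ C 2^{-n}, with C independent of n. -/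

import Mathlib

open MeasureTheory Filter FourierTransform Real ENNReal
noncomputable section

variable {V : Type*} [NormedAddCommGroup V] [InnerProductSpace ℝ V]
  [MeasurableSpace V] [BorelSpace V] [FiniteDimensional ℝ V]

/-- An admissible Littlewood–Paley pair `(χ, φ)` of smooth functions valued in `[0,1]`
with `supp χ ⊆ {‖ξ‖ ≤ 4/3}`, `supp φ ⊆ {3/4 ≤ ‖ξ‖ ≤ 8/3}` and
`χ(ξ) + ∑_{j ≥ 0} φ(2⁻ʲξ) = 1`. -/
structure LPPair (V : Type*) [NormedAddCommGroup V] [InnerProductSpace ℝ V] : Type _ where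
  chi : V → ℝ
  phi : V → ℝ
  chi_smooth : ContDiff ℝ (⊤ : ℕ∞) chi
  phi_smooth : ContDiff ℝ (⊤ : ℕ∞) phi
  chi_mem : ∀ ξ, chi ξ ∈ Set.Icc (0:ℝ) 1
  phi_mem : ∀ ξ, phi ξ ∈ Set.Icc (0:ℝ) 1
  chi_supp : ∀ ξ, chi ξ ≠ 0 → ‖ξ‖ ≤ 4/3
  phi_supp : ∀ ξ, phi ξ ≠ 0 → 3/4 ≤ ‖ξ‖ ∧ ‖ξ‖ ≤ 8/3
  partition : ∀ ξ, chi ξ + ∑' j : ℕ, phi ((2:ℝ)^(-(j:ℤ)) • ξ) = 1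

/-- The nonhomogeneous dyadic block `Δ_j` associated to the pair `P`. -/
def LPPair.block (P : LPPair V) (j : ℤ) (u : V → ℂ) : V → ℂ :=
  if j ≤ -2 then 0
  else if j = -1 then 𝓕⁻ (fun ξ => (P.chi ξ : ℂ) * 𝓕 u ξ)
  else 𝓕⁻ (fun ξ => ((P.phi ((2:ℝ)^(-j) • ξ) : ℝ) : ℂ) * 𝓕 u ξ)

/-- The `ℓ^r(ℤ)` norm of a sequence of extended nonnegative reals. -/
def lqNorm (r : ℝ≥0∞) (a : ℤ → ℝ≥0∞) : ℝ≥0∞ :=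
  if r = ∞ then ⨆ j, a j else (∑' j, a j ^ r.toReal) ^ (1 / r.toReal)

/-- The nonhomogeneous Besov norm `‖u‖_{B^s_{p,r}}` built from the pair `P`. -/
def besovNorm (P : LPPair V) (s : ℝ) (p r : ℝ≥0∞) (u : V → ℂ) : ℝ≥0∞ :=
  lqNorm r (fun j => ENNReal.ofReal ((2:ℝ)^((j:ℝ)*s)) * eLpNorm (P.block j u) p volume)

/-- Besov norm of a real-valued function. -/
def besovNormR (P : LPPair V) (s : ℝ) (p r : ℝ≥0∞) (u : V → ℝ) : ℝ≥0∞ :=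
  besovNorm P s p r (fun x => (u x : ℂ))

/-- The complexification of a real-valued function on `ℝ`. -/
def cplx (u : ℝ → ℝ) : ℝ → ℂ := fun x => (u x : ℂ)

/-- The Fourier multiplier operator `(1 - ∂_x²)⁻¹` on the line. -/
def lowOp (u : ℝ → ℂ) : ℝ → ℂ :=
  𝓕⁻ (fun ξ : ℝ => (((1 + (2*π*ξ)^2)⁻¹ : ℝ) : ℂ) * 𝓕 u ξ)

/-- The Fourier multiplier operator `∂_x (1 - ∂_x²)⁻¹` on the line. -/
def dLowOp (u : ℝ → ℂ) : ℝ → ℂ :=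
  𝓕⁻ (fun ξ : ℝ => ((2*π*ξ : ℝ) : ℂ) * Complex.I * (((1 + (2*π*ξ)^2)⁻¹ : ℝ) : ℂ) * 𝓕 u ξ)

end

open scoped SchwartzMap ContDiff

/-- For `r ≥ 1`, the `ℓ^r` norm is at most the `ℓ^1` norm. -/
theorem lqNorm_le_tsum {r : ℝ≥0∞} (hr : 1 ≤ r) (a : ℤ → ℝ≥0∞) : lqNorm r a ≤ ∑' j, a j := by
  unfold lqNorm
  split_ifs with h
  · exact iSup_le fun j => ENNReal.le_tsum j
  · have hr1 : 1 ≤ r.toReal := by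
      simpa using (ENNReal.toReal_le_toReal (by simp) h).2 hr
    have hr0 : 0 < r.toReal := one_pos.trans_le hr1
    set S := ∑' j, a j
    have split (x : ℝ≥0∞) : x ^ r.toReal = x * x ^ (r.toReal - 1) := by
      conv_lhs => rw [← add_sub_cancel 1 r.toReal]
      rw [ENNReal.rpow_add_of_nonneg _ _ zero_le_one (by linarith), ENNReal.rpow_one]
    have key : ∑' j, a j ^ r.toReal ≤ S ^ r.toReal := by
      calc ∑' j, a j ^ r.toReal ≤ ∑' j, a j * S ^ (r.toReal - 1) := by
            refine ENNReal.tsum_le_tsum fun j => ?_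
            rw [split]
            gcongr
            exact ENNReal.le_tsum j
        _ = S ^ r.toReal := by rw [ENNReal.tsum_mul_right, split]
    calc _ ≤ (S ^ r.toReal) ^ (1 / r.toReal) := by gcongr
      _ = S := by rw [← ENNReal.rpow_mul, mul_one_div_cancel hr0.ne', ENNReal.rpow_one]

/-- The Fourier symbol of the dyadic block `Δ_j`. -/
noncomputable def LPPair.symbol (P : LPPair ℝ) (j : ℤ) (ξ : ℝ) : ℝ :=
  if j ≤ -2 then 0 else if j = -1 then P.chi ξ else P.phi ((2 : ℝ) ^ (-j) • ξ)

theorem LPPair.block_eq_fourierInv (P : LPPair ℝ) (j : ℤ) (u : ℝ → ℂ) :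
    P.block j u = 𝓕⁻ (fun ξ => (P.symbol j ξ : ℂ) * 𝓕 u ξ) := by
  unfold LPPair.block LPPair.symbol
  split_ifs
  · ext x
    simp [Real.fourierInv_eq']
  · rfl
  · rfl

theorem LPPair.contDiff_symbol (P : LPPair ℝ) (j : ℤ) : ContDiff ℝ ∞ (P.symbol j) := by
  unfold LPPair.symbol
  split_ifs
  · exact contDiff_const
  · exact P.chi_smooth
  · exact P.phi_smooth.comp (contDiff_const_smul _)

theorem LPPair.symbol_support (P : LPPair ℝ) {j : ℤ} {ξ : ℝ} (h : P.symbol j ξ ≠ 0) :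
    -1 ≤ j ∧ |ξ| ≤ 8 / 3 * 2 ^ j ∧ (j = -1 ∨ 3 / 4 * 2 ^ j ≤ |ξ|) := by
  unfold LPPair.symbol at h
  split_ifs at h with h1 h2
  · exact absurd rfl h
  · subst h2
    have := P.chi_supp ξ h
    rw [Real.norm_eq_abs] at this
    refine ⟨le_rfl, ?_, Or.inl rfl⟩
    norm_num
    linarith
  · have := P.phi_supp _ h
    have h2j : (0 : ℝ) < 2 ^ j := by positivity
    rw [norm_smul, zpow_neg, Real.norm_eq_abs, Real.norm_eq_abs, abs_of_pos (inv_pos.2 h2j),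
      inv_mul_eq_div, le_div_iff₀ h2j, div_le_iff₀ h2j] at this
    exact ⟨by omega, this.2, Or.inr this.1⟩

theorem exists_forall_norm_iteratedFDeriv_le {f : ℝ → ℝ} (hf : ContDiff ℝ ∞ f)
    (hc : HasCompactSupport f) (i : ℕ) : ∃ C, ∀ x, ‖iteratedFDeriv ℝ i f x‖ ≤ C :=
  (hc.iteratedFDeriv i).exists_bound_of_continuous
    (hf.continuous_iteratedFDeriv (mod_cast le_top))

theorem hasCompactSupport_of_norm_le {f : ℝ → ℝ} {R : ℝ} (h : ∀ x, f x ≠ 0 → ‖x‖ ≤ R) :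
    HasCompactSupport f :=
  HasCompactSupport.of_support_subset_isCompact (isCompact_closedBall 0 R) fun x hx => by
    simpa using h x hx

/-- The derivatives of the dyadic symbols are bounded uniformly in the dyadic index. -/
theorem LPPair.exists_norm_iteratedFDeriv_symbol_le (P : LPPair ℝ) :
    ∃ B : ℕ → ℝ, ∀ j i ξ, ‖iteratedFDeriv ℝ i (P.symbol j) ξ‖ ≤ B i := by
  choose C₁ hC₁ using exists_forall_norm_iteratedFDeriv_le P.chi_smooth
    (hasCompactSupport_of_norm_le P.chi_supp)
  choose C₂ hC₂ using exists_forall_norm_iteratedFDeriv_le P.phi_smooth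
    (hasCompactSupport_of_norm_le fun x hx => (P.phi_supp x hx).2)
  have nonneg₁ (i) : 0 ≤ C₁ i := (norm_nonneg _).trans (hC₁ i 0)
  have nonneg₂ (i) : 0 ≤ C₂ i := (norm_nonneg _).trans (hC₂ i 0)
  refine ⟨fun i => C₁ i + C₂ i, fun j i ξ => ?_⟩
  rcases le_or_gt j (-2) with h | h
  · have : P.symbol j = fun _ => 0 := by ext; simp [LPPair.symbol, h]
    rw [this, iteratedFDeriv_fun_zero]
    simpa using add_nonneg (nonneg₁ i) (nonneg₂ i)
  rcases eq_or_ne j (-1) with rfl | h'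
  · have : P.symbol (-1) = P.chi := by ext; simp [LPPair.symbol]
    rw [this]
    linarith [hC₁ i ξ, nonneg₂ i]
  · have : P.symbol j = fun ξ => P.phi ((2 : ℝ) ^ (-j) * ξ) := by
      ext
      simp [LPPair.symbol, not_le.2 h, h']
    have hc : |(2 : ℝ) ^ (-j)| ≤ 1 := by
      rw [abs_of_pos (by positivity)]
      exact zpow_le_one_of_nonpos₀ (by norm_num) (by omega)
    rw [this, norm_iteratedFDeriv_eq_norm_iteratedDeriv, iteratedDeriv_comp_const_smul
      (P.phi_smooth.of_le (mod_cast le_top)), norm_smul, norm_pow, Real.norm_eq_abs,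
      ← norm_iteratedFDeriv_eq_norm_iteratedDeriv]
    have := mul_le_mul (pow_le_one₀ (n := i) (abs_nonneg _) hc)
      (hC₂ i ((2 : ℝ) ^ (-j) * ξ)) (norm_nonneg _) zero_le_one
    linarith [nonneg₁ i]

theorem hasTemperateGrowth_of_norm_iteratedFDeriv_le {m : ℝ → ℝ} (hm : ContDiff ℝ ∞ m)
    {B : ℕ → ℝ} (hB : ∀ i ξ, ‖iteratedFDeriv ℝ i m ξ‖ ≤ B i) : m.HasTemperateGrowth :=
  ⟨hm, fun i => ⟨0, B i, fun x => by simpa using hB i x⟩⟩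

theorem LPPair.hasTemperateGrowth_symbol (P : LPPair ℝ) (j : ℤ) :
    (P.symbol j).HasTemperateGrowth := by
  obtain ⟨B, hB⟩ := P.exists_norm_iteratedFDeriv_symbol_le
  exact hasTemperateGrowth_of_norm_iteratedFDeriv_le (P.contDiff_symbol j) (hB j)

/-- On Schwartz functions, the dyadic block is a Fourier multiplier. -/
theorem LPPair.block_eq_fourierMultiplierCLM (P : LPPair ℝ) (j : ℤ) (u : 𝓢(ℝ, ℂ)) :
    P.block j u = SchwartzMap.fourierMultiplierCLM ℂ (fun ξ => (P.symbol j ξ : ℂ)) u := by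
  have hg : (fun ξ => (P.symbol j ξ : ℂ)).HasTemperateGrowth := by
    have := P.hasTemperateGrowth_symbol j
    fun_prop
  rw [P.block_eq_fourierInv, SchwartzMap.fourierMultiplierCLM_apply, SchwartzMap.fourierInv_coe,
    SchwartzMap.smulLeftCLM_apply hg]
  rfl

/-- A multiplier with bounded derivatives maps a fixed Schwartz function to a function whose
inverse Fourier transform is bounded in `L^p`, uniformly in terms of the derivative bounds. -/
theorem exists_eLpNorm_fourierInv_mul_le (p : ℝ≥0∞) (B : ℕ → ℝ) (h : 𝓢(ℝ, ℂ)) :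
    ∃ M : ℝ, 0 ≤ M ∧ ∀ m : ℝ → ℝ, ContDiff ℝ ∞ m →
      (∀ i ξ, ‖iteratedFDeriv ℝ i m ξ‖ ≤ B i) →
      eLpNorm (𝓕⁻ (fun ξ => (m ξ : ℂ) * h ξ)) p volume ≤ ENNReal.ofReal M := by
  obtain ⟨k, C, hC⟩ := SchwartzMap.eLpNorm_le_seminorm ℝ ℂ p (volume : Measure ℝ)
  set q : Seminorm ℝ 𝓢(ℝ, ℂ) := ((Finset.Iic (k, 0)).sup (schwartzSeminormFamily ℝ ℝ ℂ)).comp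
    (fourierInvCLM ℝ 𝓢(ℝ, ℂ)).toLinearMap with hq
  have hqc : Continuous q := by
    have hsup := Seminorm.continuous_finsetSup (p := schwartzSeminormFamily ℝ ℝ ℂ)
      (s := Finset.Iic (k, 0)) fun i _ => (schwartz_withSeminorms ℝ ℝ ℂ).continuous_seminorm i
    exact hsup.comp (fourierInvCLM ℝ 𝓢(ℝ, ℂ)).continuous
  obtain ⟨t, D, -, hD⟩ := Seminorm.bound_of_continuous (schwartz_withSeminorms ℝ ℝ ℂ) q hqc
  set Q : ℕ × ℕ → ℝ := fun kl => ∑ i ∈ Finset.range (kl.2 + 1),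
    (kl.2.choose i : ℝ) * B i * SchwartzMap.seminorm ℝ kl.1 (kl.2 - i) h with hQ
  refine ⟨C * (D * ∑ kl ∈ t, |Q kl|), by positivity, fun m hm hB => ?_⟩
  have hmt := hasTemperateGrowth_of_norm_iteratedFDeriv_le hm hB
  have hB0 (i) : 0 ≤ B i := (norm_nonneg _).trans (hB i 0)
  set g : 𝓢(ℝ, ℂ) := SchwartzMap.smulLeftCLM ℂ m h with hg
  have hgc : (g : ℝ → ℂ) = fun ξ => m ξ • h ξ := SchwartzMap.smulLeftCLM_apply hmt h
  have hQ0 (kl) : 0 ≤ Q kl := Finset.sum_nonneg fun i _ => by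
    have := hB0 i
    positivity
  have hgQ (kl : ℕ × ℕ) : schwartzSeminormFamily ℝ ℝ ℂ kl g ≤ Q kl := by
    refine SchwartzMap.seminorm_le_bound ℝ kl.1 kl.2 g (hQ0 kl) fun x => ?_
    rw [hgc]
    calc _ ≤ ‖x‖ ^ kl.1 * ∑ i ∈ Finset.range (kl.2 + 1), (kl.2.choose i : ℝ) *
          ‖iteratedFDeriv ℝ i m x‖ * ‖iteratedFDeriv ℝ (kl.2 - i) h x‖ := by
          gcongr
          exact norm_iteratedFDeriv_smul_le hm (h.smooth ⊤) x (mod_cast le_top)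
      _ ≤ Q kl := by
          rw [Finset.mul_sum]
          refine Finset.sum_le_sum fun i _ => ?_
          calc _ = (kl.2.choose i : ℝ) * ‖iteratedFDeriv ℝ i m x‖ *
                (‖x‖ ^ kl.1 * ‖iteratedFDeriv ℝ (kl.2 - i) h x‖) := by ring
            _ ≤ _ := by
              gcongr
              · have := hB0 i
                positivity
              · exact hB i x
              · exact SchwartzMap.le_seminorm ℝ _ _ h x
  have hfun : 𝓕⁻ (fun ξ => (m ξ : ℂ) * h ξ) = ((𝓕⁻ g : 𝓢(ℝ, ℂ)) : ℝ → ℂ) := by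
    rw [SchwartzMap.fourierInv_coe, hgc]
    simp only [Complex.real_smul]
  rw [hfun]
  refine (hC _).trans ?_
  rw [← ENNReal.ofReal_coe_nnreal, ← ENNReal.ofReal_mul C.coe_nonneg]
  refine ENNReal.ofReal_le_ofReal ?_
  gcongr
  calc _ = q g := rfl
    _ ≤ (D • t.sup (schwartzSeminormFamily ℝ ℝ ℂ)) g := hD g
    _ = D * t.sup (schwartzSeminormFamily ℝ ℝ ℂ) g := rfl
    _ ≤ D * ∑ kl ∈ t, |Q kl| := by
      gcongr
      refine (Seminorm.finset_sup_le_sum _ t g).trans ?_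
      rw [← FunLike.coeAddMonoidHom_apply, map_sum, Finset.sum_apply]
      exact Finset.sum_le_sum fun kl _ => (hgQ kl).trans (le_abs_self _)

theorem fourierInv_comp_sub (F : ℝ → ℂ) (a x : ℝ) :
    𝓕⁻ (fun ξ => F (ξ - a)) x = Complex.exp (2 * π * a * x * Complex.I) * 𝓕⁻ F x := by
  rw [Real.fourierInv_eq', Real.fourierInv_eq', ← integral_const_mul,
    ← integral_sub_right_eq_self (fun ξ => Complex.exp (2 * π * a * x * Complex.I) *
      (Complex.exp (((2 * π * inner ℝ ξ x : ℝ) : ℂ) * Complex.I) • F ξ)) a]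
  congr 1 with ξ
  rw [smul_eq_mul, smul_eq_mul, ← mul_assoc, ← Complex.exp_add]
  congr 2
  simp
  ring

/-- The modulation `x ↦ exp(2πiax) ψ(x)` of a Schwartz function. -/
noncomputable def modulate (a : ℝ) (ψ : 𝓢(ℝ, ℂ)) : 𝓢(ℝ, ℂ) :=
  𝓕⁻ (SchwartzMap.compSubConstCLM ℂ a (𝓕 ψ))

theorem modulate_apply (a : ℝ) (ψ : 𝓢(ℝ, ℂ)) (x : ℝ) :
    modulate a ψ x = Complex.exp (2 * π * a * x * Complex.I) * ψ x := by
  have h : 𝓕⁻ ((𝓕 ψ : 𝓢(ℝ, ℂ)) : ℝ → ℂ) x = ψ x := by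
    rw [← SchwartzMap.fourierInv_coe, FourierTransform.fourierInv_fourier_eq]
  rw [modulate, SchwartzMap.fourierInv_coe, ← h, ← fourierInv_comp_sub]
  rfl

theorem fourier_modulate (a : ℝ) (ψ : 𝓢(ℝ, ℂ)) (ξ : ℝ) :
    𝓕 (modulate a ψ : ℝ → ℂ) ξ = 𝓕 ψ (ξ - a) := by
  rw [← SchwartzMap.fourier_coe, modulate, FourierTransform.fourier_fourierInv_eq,
    SchwartzMap.compSubConstCLM_apply]

/-- The Besov norm with summability index `1`, on Schwartz functions. -/
noncomputable def besovOne (P : LPPair ℝ) (σ : ℝ) (p : ℝ≥0∞) (u : 𝓢(ℝ, ℂ)) : ℝ≥0∞ :=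
  ∑' j : ℤ, ENNReal.ofReal ((2 : ℝ) ^ ((j : ℝ) * σ)) * eLpNorm (P.block j u) p volume

theorem besovNorm_le_besovOne (P : LPPair ℝ) (σ : ℝ) (p : ℝ≥0∞) {r : ℝ≥0∞} (hr : 1 ≤ r)
    (u : 𝓢(ℝ, ℂ)) : besovNorm P σ p r u ≤ besovOne P σ p u :=
  lqNorm_le_tsum hr _

theorem besovOne_add_le (P : LPPair ℝ) (σ : ℝ) {p : ℝ≥0∞} (hp : 1 ≤ p) (u v : 𝓢(ℝ, ℂ)) :
    besovOne P σ p (u + v) ≤ besovOne P σ p u + besovOne P σ p v := by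
  unfold besovOne
  rw [← ENNReal.tsum_add]
  refine ENNReal.tsum_le_tsum fun j => ?_
  rw [← mul_add]
  gcongr
  simp only [P.block_eq_fourierMultiplierCLM, map_add]
  exact eLpNorm_add_le (SchwartzMap.continuous _).aestronglyMeasurable
    (SchwartzMap.continuous _).aestronglyMeasurable hp

theorem besovOne_smul (P : LPPair ℝ) (σ : ℝ) (p : ℝ≥0∞) (c : ℂ) (u : 𝓢(ℝ, ℂ)) :
    besovOne P σ p (c • u) = ‖c‖ₑ * besovOne P σ p u := by
  unfold besovOne
  rw [← ENNReal.tsum_mul_left]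
  refine tsum_congr fun j => ?_
  simp only [P.block_eq_fourierMultiplierCLM, map_smul]
  have := eLpNorm_const_smul c
    (SchwartzMap.fourierMultiplierCLM ℂ (fun ξ => (P.symbol j ξ : ℂ)) u : ℝ → ℂ) p volume
  rw [mul_left_comm, ← this]
  rfl

/-- Dyadic blocks are bounded on all modulations of a fixed Schwartz function, uniformly in the
dyadic index and in the modulation frequency. -/
theorem exists_eLpNorm_block_modulate_le (P : LPPair ℝ) (p : ℝ≥0∞) (ψ : 𝓢(ℝ, ℂ)) :
    ∃ M : ℝ, 0 ≤ M ∧ ∀ j a, eLpNorm (P.block j (modulate a ψ)) p volume ≤ ENNReal.ofReal M := by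
  obtain ⟨B, hB⟩ := P.exists_norm_iteratedFDeriv_symbol_le
  obtain ⟨M, hM0, hM⟩ := exists_eLpNorm_fourierInv_mul_le p B (𝓕 ψ)
  refine ⟨M, hM0, fun j a => ?_⟩
  have hshift : P.block j (modulate a ψ) = fun x : ℝ => Complex.exp (2 * π * a * x * Complex.I) *
      𝓕⁻ (fun ξ => (P.symbol j (ξ + a) : ℂ) * (𝓕 ψ : 𝓢(ℝ, ℂ)) ξ) x := by
    ext x
    rw [P.block_eq_fourierInv, ← fourierInv_comp_sub]
    simp only [fourier_modulate, sub_add_cancel]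
  have hnorm : eLpNorm (P.block j (modulate a ψ)) p volume =
      eLpNorm (𝓕⁻ (fun ξ => (P.symbol j (ξ + a) : ℂ) * (𝓕 ψ : 𝓢(ℝ, ℂ)) ξ)) p volume := by
    refine eLpNorm_congr_norm_ae (ae_of_all _ fun x => ?_)
    rw [hshift, norm_mul]
    have : (2 * π * a * x * Complex.I : ℂ) = ((2 * π * a * x : ℝ) : ℂ) * Complex.I := by
      push_cast
      ring
    rw [this, Complex.norm_exp_ofReal_mul_I, one_mul]
  rw [hnorm]
  refine hM (fun ξ => P.symbol j (ξ + a)) ((P.contDiff_symbol j).comp (by fun_prop)) fun i ξ => ?_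
  rw [iteratedFDeriv_comp_add_right]
  exact hB j i _

/-- The Fourier transform of `ψ` is supported in `[-R, R]`. -/
def BandLimited (R : ℝ) (ψ : 𝓢(ℝ, ℂ)) : Prop :=
  ∀ ξ, (𝓕 ψ : 𝓢(ℝ, ℂ)) ξ ≠ 0 → |ξ| ≤ R

theorem block_modulate_support (P : LPPair ℝ) {R : ℝ} {ψ : 𝓢(ℝ, ℂ)} (hψ : BandLimited R ψ)
    {j : ℤ} {a : ℝ} (h : P.block j (modulate a ψ) ≠ 0) :
    -1 ≤ j ∧ |a| ≤ 8 / 3 * 2 ^ j + R ∧ (j = -1 ∨ 3 / 4 * 2 ^ j ≤ |a| + R) := by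
  obtain ⟨ξ, hξ⟩ : ∃ ξ, (P.symbol j ξ : ℂ) * (𝓕 ψ : 𝓢(ℝ, ℂ)) (ξ - a) ≠ 0 := by
    by_contra! hz
    refine h ?_
    rw [P.block_eq_fourierInv]
    simp only [fourier_modulate, hz]
    ext x
    simp [Real.fourierInv_eq']
  have h1 := P.symbol_support (Complex.ofReal_ne_zero.1 (left_ne_zero_of_mul hξ))
  have h2 := hψ _ (right_ne_zero_of_mul hξ)
  have h3 : |a| ≤ |ξ| + |ξ - a| := by
    have := abs_sub ξ (ξ - a)
    rwa [_root_.sub_sub_cancel] at this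
  have h4 : |ξ| ≤ |a| + |ξ - a| := by
    have := abs_add_le a (ξ - a)
    rwa [add_sub_cancel] at this
  exact ⟨h1.1, by linarith [h1.2.1], h1.2.2.imp id fun h5 => by linarith⟩

/-- A modulation at frequency comparable to `2 ^ N` of a band-limited function has Besov norm
of order `2 ^ (N σ)`. -/
theorem exists_besovOne_modulate_le (P : LPPair ℝ) (σ : ℝ) (p : ℝ≥0∞) {R : ℝ} (hR : 0 ≤ R)
    {ψ : 𝓢(ℝ, ℂ)} (hψ : BandLimited R ψ) {A : ℝ} (hA : 0 ≤ A) :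
    ∃ C : ℝ, 0 ≤ C ∧ ∀ (N : ℕ) (a : ℝ), |a| ≤ A * 2 ^ N → 2 ^ N ≤ A * (|a| + 1) →
      besovOne P σ p (modulate a ψ) ≤ ENNReal.ofReal (C * 2 ^ ((N : ℝ) * σ)) := by
  obtain ⟨M, hM0, hM⟩ := exists_eLpNorm_block_modulate_le P p ψ
  obtain ⟨K, hK⟩ := pow_unbounded_of_one_lt
    (max (4 / 3 * (A + R) + 1) (A * (8 / 3 + 2 * (R + 1)))) (one_lt_two : (1 : ℝ) < 2)
  have hK1 := (le_max_left _ _).trans hK.le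
  have hK2 := (le_max_right _ _).trans hK.le
  refine ⟨(2 * K + 1) * (2 ^ (K * |σ|) * M), by positivity, fun N a ha₁ ha₂ => ?_⟩
  have h2N : (1 : ℝ) ≤ 2 ^ N := one_le_pow₀ one_le_two
  have window (j : ℤ) (hj : P.block j (modulate a ψ) ≠ 0) :
      j ∈ Finset.Icc ((N : ℤ) - K) (N + K) := by
    obtain ⟨h1, h2, h3⟩ := block_modulate_support P hψ hj
    have h2j : (1 / 2 : ℝ) ≤ 2 ^ j := by
      have := zpow_le_zpow_right₀ (one_le_two : (1 : ℝ) ≤ 2) h1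
      norm_num at this ⊢
      exact this
    rw [Finset.mem_Icc]
    constructor
    · suffices (2 : ℝ) ^ (N : ℤ) ≤ 2 ^ (K + j) by
        have := (zpow_le_zpow_iff_right₀ (one_lt_two : (1 : ℝ) < 2)).1 this
        omega
      rw [zpow_add₀ two_ne_zero, zpow_natCast, zpow_natCast]
      calc (2 : ℝ) ^ N ≤ A * (|a| + 1) := ha₂
        _ ≤ A * ((8 / 3 + 2 * (R + 1)) * 2 ^ j) := by
          gcongr
          nlinarith
        _ = A * (8 / 3 + 2 * (R + 1)) * 2 ^ j := by ring
        _ ≤ 2 ^ K * 2 ^ j := by gcongr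
    · suffices (2 : ℝ) ^ j ≤ 2 ^ ((N : ℤ) + K) from
        (zpow_le_zpow_iff_right₀ (one_lt_two : (1 : ℝ) < 2)).1 this
      rw [zpow_add₀ two_ne_zero, zpow_natCast, zpow_natCast]
      have h4 : (2 : ℝ) ^ j ≤ (4 / 3 * (A + R) + 1) * 2 ^ N := by
        rcases h3 with rfl | h3
        · have : 0 ≤ 4 / 3 * (A + R) * 2 ^ N := by positivity
          norm_num
          linarith
        · nlinarith
      calc _ ≤ _ := h4
        _ ≤ 2 ^ K * 2 ^ N := by gcongr
        _ = _ := mul_comm _ _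
  have term (j : ℤ) (hj : j ∈ Finset.Icc ((N : ℤ) - K) (N + K)) :
      ENNReal.ofReal ((2 : ℝ) ^ ((j : ℝ) * σ)) * eLpNorm (P.block j (modulate a ψ)) p volume ≤
        ENNReal.ofReal (2 ^ (K * |σ|) * M * 2 ^ ((N : ℝ) * σ)) := by
    rw [Finset.mem_Icc] at hj
    have hjN : |(j : ℝ) - N| ≤ K := by
      have h1 : (N : ℝ) - K ≤ j := mod_cast hj.1
      have h2 : (j : ℝ) ≤ N + K := mod_cast hj.2
      rw [abs_le]
      constructor <;> linarith
    have hexp : (j : ℝ) * σ ≤ K * |σ| + N * σ := by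
      have h1 : ((j : ℝ) - N) * σ ≤ |(j : ℝ) - N| * |σ| := by
        rw [← abs_mul]
        exact le_abs_self _
      have h2 := mul_le_mul_of_nonneg_right hjN (abs_nonneg σ)
      linarith
    calc _ ≤ ENNReal.ofReal ((2 : ℝ) ^ (K * |σ| + N * σ)) * ENNReal.ofReal M := by
          gcongr
          · exact one_le_two
          · exact hM j a
      _ = _ := by
        rw [← ENNReal.ofReal_mul (by positivity), Real.rpow_add two_pos]
        congr 1
        ring
  calc besovOne P σ p (modulate a ψ)
      = ∑ j ∈ Finset.Icc ((N : ℤ) - K) (N + K), ENNReal.ofReal ((2 : ℝ) ^ ((j : ℝ) * σ)) *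
          eLpNorm (P.block j (modulate a ψ)) p volume := by
        refine tsum_eq_sum fun j hj => ?_
        rw [not_not.1 (mt (window j) hj), eLpNorm_zero, mul_zero]
    _ ≤ _ := Finset.sum_le_card_nsmul _ _ _ term
    _ = _ := by
      have hcard : (Finset.Icc ((N : ℤ) - K) (N + K)).card = 2 * K + 1 := by
        rw [Int.card_Icc]
        omega
      rw [hcard, ← ENNReal.ofReal_nsmul, nsmul_eq_mul]
      push_cast
      congr 1
      ring

theorem BandLimited.mul {R₁ R₂ : ℝ} {f g : 𝓢(ℝ, ℂ)} (hf : BandLimited R₁ f)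
    (hg : BandLimited R₂ g) :
    BandLimited (R₁ + R₂) (SchwartzMap.pairing (ContinuousLinearMap.mul ℂ ℂ) f g) := by
  intro ξ
  contrapose!
  intro hξ
  have hdouble (h : 𝓢(ℝ, ℂ)) (x : ℝ) : (𝓕 (𝓕 h : 𝓢(ℝ, ℂ)) : 𝓢(ℝ, ℂ)) x = h (-x) := by
    have := Real.fourierInv_eq_fourier_neg ((𝓕 h : 𝓢(ℝ, ℂ)) : ℝ → ℂ) (-x)
    rw [← SchwartzMap.fourierInv_coe, FourierTransform.fourierInv_fourier_eq, neg_neg] at this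
    rw [this, SchwartzMap.fourier_coe]
  have hconv : (𝓕 (SchwartzMap.pairing (ContinuousLinearMap.mul ℂ ℂ) f g) : 𝓢(ℝ, ℂ)) =
      SchwartzMap.convolution (ContinuousLinearMap.mul ℂ ℂ) (𝓕 f) (𝓕 g) := by
    refine (FourierTransform.fourierCLE ℂ 𝓢(ℝ, ℂ)).injective ?_
    simp only [FourierTransform.fourierCLE_apply, SchwartzMap.fourier_convolution]
    ext x
    simp only [hdouble, SchwartzMap.pairing_apply_apply]
  rw [hconv, SchwartzMap.convolution_apply, convolution_def]
  refine integral_eq_zero_of_ae (ae_of_all _ fun t => ?_)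
  by_contra hne
  have h1 := hf t fun h0 => hne (by simp [h0])
  have h2 := hg (ξ - t) fun h0 => hne (by simp [h0])
  have := abs_add_le t (ξ - t)
  rw [add_sub_cancel] at this
  linarith

theorem BandLimited.deriv {R : ℝ} {f : 𝓢(ℝ, ℂ)} (hf : BandLimited R f) :
    BandLimited R (SchwartzMap.derivCLM ℂ ℂ f) := by
  intro ξ hξ
  refine hf ξ fun h0 => hξ ?_
  rw [SchwartzMap.fourier_coe] at h0 ⊢
  have hd : ((SchwartzMap.derivCLM ℂ ℂ f : 𝓢(ℝ, ℂ)) : ℝ → ℂ) = _root_.deriv f := by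
    ext x
    simp
  rw [hd, Real.fourier_deriv f.integrable f.differentiable
    (by rw [← hd]; exact SchwartzMap.integrable _)]
  simp [h0]

/-- The Besov norm of `U n` grows at most like `2 ^ (n e)`. -/
def HasBesovGrowth (P : LPPair ℝ) (σ : ℝ) (p : ℝ≥0∞) (e : ℝ) (U : ℕ → 𝓢(ℝ, ℂ)) : Prop :=
  ∃ C : ℝ, 0 ≤ C ∧ ∀ n, besovOne P σ p (U n) ≤ ENNReal.ofReal (C * 2 ^ ((n : ℝ) * e))

theorem HasBesovGrowth.add {P : LPPair ℝ} {σ : ℝ} {p : ℝ≥0∞} (hp : 1 ≤ p) {e : ℝ}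
    {U V : ℕ → 𝓢(ℝ, ℂ)} (hU : HasBesovGrowth P σ p e U) (hV : HasBesovGrowth P σ p e V) :
    HasBesovGrowth P σ p e (fun n => U n + V n) := by
  obtain ⟨C, hC, hU⟩ := hU
  obtain ⟨C', hC', hV⟩ := hV
  refine ⟨C + C', by positivity, fun n => ?_⟩
  rw [add_mul, ENNReal.ofReal_add (by positivity) (by positivity)]
  exact (besovOne_add_le P σ hp _ _).trans (add_le_add (hU n) (hV n))

theorem HasBesovGrowth.smul {P : LPPair ℝ} {σ : ℝ} {p : ℝ≥0∞} {e : ℝ} {U : ℕ → 𝓢(ℝ, ℂ)}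
    (hU : HasBesovGrowth P σ p e U) (c : ℂ) {e' t : ℝ} (ht : e' + e ≤ t) :
    HasBesovGrowth P σ p t (fun n => (c * ((2 ^ ((n : ℝ) * e') : ℝ) : ℂ)) • U n) := by
  obtain ⟨C, hC, hU⟩ := hU
  refine ⟨‖c‖ * C, by positivity, fun n => ?_⟩
  have hpow : (0 : ℝ) < 2 ^ ((n : ℝ) * e') := by positivity
  rw [besovOne_smul, ← ofReal_norm, norm_mul, Complex.norm_real, Real.norm_of_nonneg hpow.le]
  refine (mul_le_mul_right (hU n) _).trans ?_
  rw [← ENNReal.ofReal_mul (by positivity)]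
  refine ENNReal.ofReal_le_ofReal ?_
  have h : (2 : ℝ) ^ ((n : ℝ) * e') * 2 ^ ((n : ℝ) * e) ≤ 2 ^ ((n : ℝ) * t) := by
    rw [← Real.rpow_add two_pos, ← mul_add]
    exact Real.rpow_le_rpow_of_exponent_le one_le_two (by gcongr)
  calc ‖c‖ * 2 ^ ((n : ℝ) * e') * (C * 2 ^ ((n : ℝ) * e))
      = ‖c‖ * C * (2 ^ ((n : ℝ) * e') * 2 ^ ((n : ℝ) * e)) := by ring
    _ ≤ ‖c‖ * C * 2 ^ ((n : ℝ) * t) := by gcongr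

theorem HasBesovGrowth.const_smul {P : LPPair ℝ} {σ : ℝ} {p : ℝ≥0∞} {e : ℝ} {U : ℕ → 𝓢(ℝ, ℂ)}
    (hU : HasBesovGrowth P σ p e U) (c : ℂ) : HasBesovGrowth P σ p e (fun n => c • U n) := by
  simpa using hU.smul c (zero_add e).le

theorem BandLimited.hasBesovGrowth_modulate (P : LPPair ℝ) (σ : ℝ) (p : ℝ≥0∞) {R : ℝ} (hR : 0 ≤ R)
    {ψ : 𝓢(ℝ, ℂ)} (hψ : BandLimited R ψ) {c : ℝ} (hc : c ≠ 0) :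
    HasBesovGrowth P σ p σ (fun n => modulate (c * 2 ^ n) ψ) := by
  have hc' : 0 < |c| := abs_pos.2 hc
  obtain ⟨C, hC, h⟩ := exists_besovOne_modulate_le P σ p hR hψ (A := |c| + |c|⁻¹) (by positivity)
  refine ⟨C, hC, fun n => h n _ ?_ ?_⟩
  · rw [abs_mul, abs_of_nonneg (by positivity : (0 : ℝ) ≤ 2 ^ n)]
    gcongr
    linarith [inv_pos.2 hc']
  · rw [abs_mul, abs_of_nonneg (by positivity : (0 : ℝ) ≤ 2 ^ n)]
    calc (2 : ℝ) ^ n = |c|⁻¹ * (|c| * 2 ^ n) := by field_simp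
      _ ≤ (|c| + |c|⁻¹) * (|c| * 2 ^ n + 1) := by
        gcongr <;> linarith

theorem BandLimited.hasBesovGrowth_const (P : LPPair ℝ) (σ : ℝ) (p : ℝ≥0∞) {R : ℝ} (hR : 0 ≤ R)
    {ψ : 𝓢(ℝ, ℂ)} (hψ : BandLimited R ψ) : HasBesovGrowth P σ p 0 (fun _ => ψ) := by
  obtain ⟨C, hC, h⟩ := exists_besovOne_modulate_le P σ p hR hψ zero_le_one
  refine ⟨C, hC, fun n => ?_⟩
  have hψ0 : modulate 0 ψ = ψ := by
    ext x
    simp [modulate_apply]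
  simpa [hψ0] using h 0 0 (by simp) (by simp)

/-- The function `x ↦ sin (2 π a x) ψ x`. -/
noncomputable def modSin (a : ℝ) (ψ : 𝓢(ℝ, ℂ)) : 𝓢(ℝ, ℂ) :=
  (-(Complex.I / 2)) • (modulate a ψ + (-1 : ℂ) • modulate (-a) ψ)

/-- The function `x ↦ cos (2 π a x) ψ x`. -/
noncomputable def modCos (a : ℝ) (ψ : 𝓢(ℝ, ℂ)) : 𝓢(ℝ, ℂ) :=
  (1 / 2 : ℂ) • (modulate a ψ + modulate (-a) ψ)

theorem modSin_apply (a : ℝ) (ψ : 𝓢(ℝ, ℂ)) (x : ℝ) :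
    modSin a ψ x = (Real.sin (2 * π * a * x) : ℂ) * ψ x := by
  simp only [modSin, smul_apply, add_apply, modulate_apply, smul_eq_mul,
    Complex.ofReal_sin, Complex.sin]
  push_cast
  ring_nf

theorem modCos_apply (a : ℝ) (ψ : 𝓢(ℝ, ℂ)) (x : ℝ) :
    modCos a ψ x = (Real.cos (2 * π * a * x) : ℂ) * ψ x := by
  simp only [modCos, smul_apply, add_apply, modulate_apply, smul_eq_mul,
    Complex.ofReal_cos, Complex.cos]
  push_cast
  ring_nf

theorem BandLimited.hasBesovGrowth_modSin (P : LPPair ℝ) (σ : ℝ) {p : ℝ≥0∞} (hp : 1 ≤ p) {R : ℝ}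
    (hR : 0 ≤ R) {ψ : 𝓢(ℝ, ℂ)} (hψ : BandLimited R ψ) {c : ℝ} (hc : c ≠ 0) :
    HasBesovGrowth P σ p σ (fun n => modSin (c * 2 ^ n) ψ) := by
  have h := hψ.hasBesovGrowth_modulate P σ p hR (neg_ne_zero.2 hc)
  simp only [neg_mul] at h
  exact ((hψ.hasBesovGrowth_modulate P σ p hR hc).add hp (h.const_smul _)).const_smul _

theorem BandLimited.hasBesovGrowth_modCos (P : LPPair ℝ) (σ : ℝ) {p : ℝ≥0∞} (hp : 1 ≤ p) {R : ℝ}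
    (hR : 0 ≤ R) {ψ : 𝓢(ℝ, ℂ)} (hψ : BandLimited R ψ) {c : ℝ} (hc : c ≠ 0) :
    HasBesovGrowth P σ p σ (fun n => modCos (c * 2 ^ n) ψ) := by
  have h := hψ.hasBesovGrowth_modulate P σ p hR (neg_ne_zero.2 hc)
  simp only [neg_mul] at h
  exact ((hψ.hasBesovGrowth_modulate P σ p hR hc).add hp h).const_smul _

/-- Expansion of the cubic interaction into pure frequencies. -/
theorem cubic_interaction_expansion (A B G D f f' θ : ℝ) :
    (A * f * Real.sin θ + B * f) ^ 2 *
        (G * (A * (f' * Real.sin θ + f * (17 / 12 * D * Real.cos θ))) + B * f') =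
      3 / 4 * (G * A ^ 3) * (Real.sin θ * (f ^ 2 * f'))
      + -1 / 4 * (G * A ^ 3) * (Real.sin (3 * θ) * (f ^ 2 * f'))
      + 1 / 2 * (A ^ 2 * B) * (f ^ 2 * f')
      + 1 * (G * A ^ 2 * B) * (f ^ 2 * f')
      + -1 / 2 * (A ^ 2 * B) * (Real.cos (2 * θ) * (f ^ 2 * f'))
      + -1 * (G * A ^ 2 * B) * (Real.cos (2 * θ) * (f ^ 2 * f'))
      + 2 * (A * B ^ 2) * (Real.sin θ * (f ^ 2 * f'))
      + 1 * (G * A * B ^ 2) * (Real.sin θ * (f ^ 2 * f'))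
      + 1 * B ^ 3 * (f ^ 2 * f')
      + 17 / 48 * (G * D * A ^ 3) * (Real.cos θ * f ^ 3)
      + -17 / 48 * (G * D * A ^ 3) * (Real.cos (3 * θ) * f ^ 3)
      + 17 / 12 * (G * D * A ^ 2 * B) * (Real.sin (2 * θ) * f ^ 3)
      + 17 / 12 * (G * D * A * B ^ 2) * (Real.cos θ * f ^ 3) := by
  have h2 : Real.cos θ ^ 2 = 1 - Real.sin θ ^ 2 := Real.cos_sq' θ
  have h3 : Real.cos θ ^ 3 = (1 - Real.sin θ ^ 2) * Real.cos θ := by rw [← h2]; ring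
  rw [Real.sin_three_mul, Real.cos_three_mul, Real.sin_two_mul, Real.cos_two_mul, h2, h3]
  ring

theorem exists_hasBesovGrowth_cubic (P : LPPair ℝ) {φ : SchwartzMap ℝ ℝ}
    (hsupp : ∀ ξ : ℝ, 𝓕 (fun x : ℝ => (φ x : ℂ)) ξ ≠ 0 → |ξ| ≤ 1 / 2)
    {p : ℝ≥0∞} (hp : 1 ≤ p) {s σ g t : ℝ} (hs : 3 / 2 < s) (hg : 0 ≤ g)
    (h₁ : g + 1 / 2 - 2 * s ≤ t) (h₂ : g - s + σ ≤ t)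
    (h₃ : -3 / 2 ≤ t) :
    ∃ U : ℕ → 𝓢(ℝ, ℂ), HasBesovGrowth P σ p t U ∧ ∀ (n : ℕ) (x : ℝ),
      U n x = (((2 ^ (-(n : ℝ) * s) * φ x * Real.sin ((17 / 12) * 2 ^ n * x) +
        2 ^ (-(n : ℝ) / 2) * φ x) ^ 2 *
        (2 ^ ((n : ℝ) * g) * (2 ^ (-(n : ℝ) * s) * (deriv φ x * Real.sin ((17 / 12) * 2 ^ n * x) +
          φ x * (17 / 12 * 2 ^ n * Real.cos ((17 / 12) * 2 ^ n * x)))) +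
          2 ^ (-(n : ℝ) / 2) * deriv φ x) : ℝ) : ℂ) := by
  let Φ : 𝓢(ℝ, ℂ) := SchwartzMap.postcompCLM (Complex.ofRealCLM) φ
  have hΦx (x : ℝ) : Φ x = (φ x : ℂ) := rfl
  have hΦ : BandLimited (1 / 2) Φ := fun ξ hξ => hsupp ξ (by
    rwa [SchwartzMap.fourier_coe] at hξ)
  have hΦ'x (x : ℝ) : SchwartzMap.derivCLM ℂ ℂ Φ x = ((deriv φ x : ℝ) : ℂ) := by
    rw [SchwartzMap.derivCLM_apply]
    exact ((φ.differentiable x).hasDerivAt.ofReal_comp).deriv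
  let Q : 𝓢(ℝ, ℂ) → 𝓢(ℝ, ℂ) := fun f => SchwartzMap.pairing (ContinuousLinearMap.mul ℂ ℂ)
    (SchwartzMap.pairing (ContinuousLinearMap.mul ℂ ℂ) Φ Φ) f
  have hQ {f : 𝓢(ℝ, ℂ)} (hf : BandLimited (1 / 2) f) : BandLimited (3 / 2) (Q f) := by
    convert (hΦ.mul hΦ).mul hf using 1
    norm_num
  have hQx (f : 𝓢(ℝ, ℂ)) (x : ℝ) : Q f x = (φ x : ℂ) ^ 2 * f x := by
    simp [Q, SchwartzMap.pairing_apply_apply, hΦx, sq]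
  have hR : (0 : ℝ) ≤ 3 / 2 := by norm_num
  have hψ₁ := hQ hΦ.deriv
  have hψ₂ := hQ hΦ
  set ψ₁ := Q (SchwartzMap.derivCLM ℂ ℂ Φ)
  set ψ₂ := Q Φ
  have hψ₁x (x : ℝ) : ψ₁ x = ((φ x ^ 2 * deriv φ x : ℝ) : ℂ) := by
    rw [hQx, hΦ'x]
    push_cast
    rfl
  have hψ₂x (x : ℝ) : ψ₂ x = ((φ x ^ 3 : ℝ) : ℂ) := by
    rw [hQx, hΦx]
    push_cast
    ring
  let c : ℝ := 17 / (24 * π)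
  have hc : c ≠ 0 := by positivity
  have hc2 : 2 * c ≠ 0 := by positivity
  have hc3 : 3 * c ≠ 0 := by positivity
  have C1 := hψ₁.hasBesovGrowth_const P σ p hR
  have S11 := hψ₁.hasBesovGrowth_modSin P σ hp hR hc
  have S13 := hψ₁.hasBesovGrowth_modSin P σ hp hR hc3
  have C12 := hψ₁.hasBesovGrowth_modCos P σ hp hR hc2
  have C21 := hψ₂.hasBesovGrowth_modCos P σ hp hR hc
  have C23 := hψ₂.hasBesovGrowth_modCos P σ hp hR hc3
  have S22 := hψ₂.hasBesovGrowth_modSin P σ hp hR hc2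
  refine ⟨_, (((((((((((
    (S11.smul (3 / 4) (e' := g - 3 * s) (t := t) (by linarith)).add hp
    (S13.smul (-1 / 4) (e' := g - 3 * s) (by linarith))).add hp
    (C1.smul (1 / 2) (e' := -2 * s - 1 / 2) (by linarith))).add hp
    (C1.smul 1 (e' := g - 2 * s - 1 / 2) (by linarith))).add hp
    (C12.smul (-1 / 2) (e' := -2 * s - 1 / 2) (by linarith))).add hp
    (C12.smul (-1) (e' := g - 2 * s - 1 / 2) (by linarith))).add hp
    (S11.smul 2 (e' := -s - 1) (by linarith))).add hp
    (S11.smul 1 (e' := g - s - 1) (by linarith))).add hp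
    (C1.smul 1 (e' := -3 / 2) (by linarith))).add hp
    (C21.smul (17 / 48) (e' := g + 1 - 3 * s) (by linarith))).add hp
    (C23.smul (-17 / 48) (e' := g + 1 - 3 * s) (by linarith))).add hp
    (S22.smul (17 / 12) (e' := g + 1 - 2 * s - 1 / 2) (by linarith))).add hp
    (C21.smul (17 / 12) (e' := g + 1 - s - 1) (by linarith)), fun n x => ?_⟩
  have pw (i j k l : ℕ) (e : ℝ) (he : e = i * g + j - k * s - l / 2) :
      (2 : ℝ) ^ ((n : ℝ) * e) = (2 ^ ((n : ℝ) * g)) ^ i * (2 ^ n) ^ j *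
        (2 ^ (-(n : ℝ) * s)) ^ k * (2 ^ (-(n : ℝ) / 2)) ^ l := by
    simp only [← Real.rpow_natCast, ← Real.rpow_mul two_pos.le, ← Real.rpow_add two_pos]
    rw [he]
    congr 1
    ring
  have hθ (k : ℝ) : 2 * π * (k * c * 2 ^ n) * x = k * (17 / 12 * 2 ^ n * x) := by
    simp only [c]
    field_simp
    ring
  have hθ1 : 2 * π * (c * 2 ^ n) * x = 17 / 12 * 2 ^ n * x := by
    simpa using hθ 1
  rw [cubic_interaction_expansion]
  simp only [add_apply, smul_apply, smul_eq_mul, modSin_apply,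
    modCos_apply, hψ₁x, hψ₂x, hθ, hθ1]
  rw [pw 1 0 3 0 (g - 3 * s) (by push_cast; ring), pw 0 0 2 1 (-2 * s - 1 / 2) (by push_cast; ring),
    pw 1 0 2 1 (g - 2 * s - 1 / 2) (by push_cast; ring), pw 0 0 1 2 (-s - 1) (by push_cast; ring),
    pw 1 0 1 2 (g - s - 1) (by push_cast; ring), pw 0 0 0 3 (-3 / 2) (by push_cast; ring),
    pw 1 1 3 0 (g + 1 - 3 * s) (by push_cast; ring),
    pw 1 1 2 1 (g + 1 - 2 * s - 1 / 2) (by push_cast; ring),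
    pw 1 1 1 2 (g + 1 - s - 1) (by push_cast; ring)]
  generalize (2 : ℝ) ^ (-(n : ℝ) * s) = A
  generalize (2 : ℝ) ^ (-(n : ℝ) / 2) = B
  generalize (2 : ℝ) ^ ((n : ℝ) * g) = G
  simp only [pow_zero, pow_one, mul_one, one_mul, Complex.ofReal_add, Complex.ofReal_mul,
    Complex.ofReal_pow, Complex.ofReal_div, Complex.ofReal_neg, Complex.ofReal_one,
    Complex.ofReal_ofNat]

theorem exists_besovNormR_cubic_le (P : LPPair ℝ) {φ : SchwartzMap ℝ ℝ}
    (hsupp : ∀ ξ : ℝ, 𝓕 (fun x : ℝ => (φ x : ℂ)) ξ ≠ 0 → |ξ| ≤ 1 / 2)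
    {p r : ℝ≥0∞} (hp : 1 ≤ p) (hr : 1 ≤ r) {s σ g t : ℝ} (hs : 3 / 2 < s) (hg : 0 ≤ g)
    (h₁ : g + 1 / 2 - 2 * s ≤ t) (h₂ : g - s + σ ≤ t)
    (h₃ : -3 / 2 ≤ t) :
    ∃ C : ℝ, 0 ≤ C ∧ ∀ n : ℕ, besovNormR P σ p r (fun x : ℝ =>
      (2 ^ (-(n : ℝ) * s) * φ x * Real.sin ((17 / 12) * 2 ^ n * x) +
        2 ^ (-(n : ℝ) / 2) * φ x) ^ 2 * deriv (fun y : ℝ =>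
          2 ^ ((n : ℝ) * g) * (2 ^ (-(n : ℝ) * s) * φ y * Real.sin ((17 / 12) * 2 ^ n * y)) +
            2 ^ (-(n : ℝ) / 2) * φ y) x) ≤ ENNReal.ofReal (C * 2 ^ ((n : ℝ) * t)) := by
  obtain ⟨U, ⟨C, hC, hU⟩, hUx⟩ := exists_hasBesovGrowth_cubic P hsupp hp hs hg h₁ h₂ h₃
  refine ⟨C, hC, fun n => le_trans (le_of_eq ?_)
    ((besovNorm_le_besovOne P σ p hr (U n)).trans (hU n))⟩
  unfold besovNormR
  congr 1
  ext x
  rw [hUx]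
  refine congrArg Complex.ofReal (congrArg (_ * ·) ?_)
  have hφ := (φ.differentiable x).hasDerivAt
  have hsin := (((hasDerivAt_id x).const_mul (17 / 12 * 2 ^ n : ℝ))).sin
  refine HasDerivAt.deriv ?_
  refine HasDerivAt.congr_deriv (((((hφ.const_mul (2 ^ (-(n : ℝ) * s) : ℝ)).mul hsin).const_mul
    (2 ^ ((n : ℝ) * g) : ℝ)).add (hφ.const_mul (2 ^ (-(n : ℝ) / 2) : ℝ)))) ?_
  simp only [id, mul_one]
  ring

/-- **Estimates for the Taylor coefficients `w₀ⁿ = v_{0,n}² ∂_x ρ̃_{0,n}` and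
`v₀ⁿ = v_{0,n}² ∂_x v_{0,n}`** where `v_{0,n} = f_n + g_n`, `ρ̃_{0,n} = 2ⁿ f_n + g_n`,
`f_n(x) = 2^{-ns}φ(x)sin((17/12)2ⁿx)`, `g_n(x) = 2^{-n/2}φ(x)`:
`‖v₀ⁿ‖_{B^{s-1}_{p,r}} ≤ C 2^{-n}`, `‖w₀ⁿ‖_{B^{s-1}_{p,r}} ≤ C`,
`‖w₀ⁿ‖_{B^{s-2}_{p,r}} ≤ C 2^{-n}`. -/
theorem taylor_coefficient_estimates
    (P : LPPair ℝ) (φ : SchwartzMap ℝ ℝ)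
    (heven : ∀ ξ : ℝ, 𝓕 (fun x : ℝ => (φ x : ℂ)) (-ξ) = 𝓕 (fun x : ℝ => (φ x : ℂ)) ξ)
    (hreal : ∀ ξ : ℝ, (𝓕 (fun x : ℝ => (φ x : ℂ)) ξ).im = 0)
    (hnonneg : ∀ ξ : ℝ, 0 ≤ (𝓕 (fun x : ℝ => (φ x : ℂ)) ξ).re)
    (hone : ∀ ξ : ℝ, |ξ| ≤ 1/4 → 𝓕 (fun x : ℝ => (φ x : ℂ)) ξ = 1)
    (hsupp : ∀ ξ : ℝ, 𝓕 (fun x : ℝ => (φ x : ℂ)) ξ ≠ 0 → |ξ| ≤ 1/2)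
    (p r : ℝ≥0∞) (hp : 1 ≤ p) (hr : 1 ≤ r)
    (s : ℝ) (hs : s > max (1 + (1/p).toReal) (3/2)) :
    ∃ C : ℝ, 0 < C ∧ ∀ n : ℕ,
      besovNormR P (s-1) p r (fun x : ℝ =>
          (2^(-(n:ℝ)*s) * φ x * Real.sin ((17/12) * 2^n * x) + 2^(-(n:ℝ)/2) * φ x)^2 *
            deriv (fun y : ℝ =>
              2^(-(n:ℝ)*s) * φ y * Real.sin ((17/12) * 2^n * y) + 2^(-(n:ℝ)/2) * φ y) x) ≤
        ENNReal.ofReal (C * 2^(-(n:ℝ))) ∧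
      besovNormR P (s-1) p r (fun x : ℝ =>
          (2^(-(n:ℝ)*s) * φ x * Real.sin ((17/12) * 2^n * x) + 2^(-(n:ℝ)/2) * φ x)^2 *
            deriv (fun y : ℝ =>
              2^(n:ℝ) * (2^(-(n:ℝ)*s) * φ y * Real.sin ((17/12) * 2^n * y)) +
                2^(-(n:ℝ)/2) * φ y) x) ≤
        ENNReal.ofReal C ∧
      besovNormR P (s-2) p r (fun x : ℝ =>
          (2^(-(n:ℝ)*s) * φ x * Real.sin ((17/12) * 2^n * x) + 2^(-(n:ℝ)/2) * φ x)^2 *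
            deriv (fun y : ℝ =>
              2^(n:ℝ) * (2^(-(n:ℝ)*s) * φ y * Real.sin ((17/12) * 2^n * y)) +
                2^(-(n:ℝ)/2) * φ y) x) ≤
        ENNReal.ofReal (C * 2^(-(n:ℝ))) := by
  have hs' : 3 / 2 < s := (le_max_right _ _).trans_lt hs
  obtain ⟨C₁, hC₁, h₁⟩ := exists_besovNormR_cubic_le P hsupp hp hr (σ := s - 1) (g := 0) (t := -1)
    hs' le_rfl (by linarith) (by linarith) (by norm_num)
  obtain ⟨C₂, hC₂, h₂⟩ := exists_besovNormR_cubic_le P hsupp hp hr (σ := s - 1) (g := 1) (t := 0)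
    hs' zero_le_one (by linarith) (by linarith) (by norm_num)
  obtain ⟨C₃, hC₃, h₃⟩ := exists_besovNormR_cubic_le P hsupp hp hr (σ := s - 2) (g := 1) (t := -1)
    hs' zero_le_one (by linarith) (by linarith) (by norm_num)
  simp only [mul_zero, mul_one, mul_neg, Real.rpow_zero, one_mul] at h₁ h₂ h₃
  refine ⟨C₁ + C₂ + C₃ + 1, by positivity, fun n => ⟨(h₁ n).trans ?_, (h₂ n).trans ?_,
    (h₃ n).trans ?_⟩⟩ <;> refine ENNReal.ofReal_le_ofReal ?_
  · gcongr
    linarith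
  · linarith
  · gcongr
    linarith
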